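/- arXiv:1107.3359 — 2 statements merged into one kernel-verified Lean document; each statement's English description precedes it below -/
import Mathlib

section
/- Let I ⊂ S' = K[x_1,…,x_r] and J ⊂ S'' = K[x_{r+1},…,x_n] be monomial ideals, where 1 ≤ r < n, and let S = K[x_1,…,x_n]. Then sdepth_S(IS) ≥ sdepth_S(IS + JS) ≥ min{ sdepth_S(IS), sdepth_{S''}(J) + sdepth_{S'}(S'/I) }. -/
open MvPolynomial

/-- The `K`-subspace `m·K[Z]` of `S = K[x_0,…,x_{n-1}]`, where `m` is the monomial with
exponent vector `a` and `Z` is a set of variables: the span of all monomials `m·w`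
with `w` a monomial in the variables of `Z`. -/
noncomputable def StanleySpace (K : Type*) [Field K] {n : ℕ} (a : Fin n →₀ ℕ)
    (Z : Finset (Fin n)) : Submodule K (MvPolynomial (Fin n) K) :=
  Submodule.span K
    {p | ∃ c : Fin n →₀ ℕ, c.support ⊆ Z ∧ p = monomial (a + c) (1 : K)}

/-- `I` is a monomial ideal, i.e. an ideal generated by monomials. -/
def IsMonomialIdeal {K : Type*} [Field K] {n : ℕ}
    (I : Ideal (MvPolynomial (Fin n) K)) : Prop :=
  ∃ G : Set (Fin n →₀ ℕ), I = Ideal.span ((fun a => monomial a (1 : K)) '' G)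

/-- The `K`-subspace of `S` spanned by the monomials lying in `I` but not in `J`.
For monomial ideals `J ⊆ I` this is the canonical `K`-vector space representative
of the `ℤⁿ`-graded module `I/J` inside `S`. -/
noncomputable def monomialSpan (K : Type*) [Field K] {n : ℕ}
    (I J : Ideal (MvPolynomial (Fin n) K)) : Submodule K (MvPolynomial (Fin n) K) :=
  Submodule.span K
    {p | ∃ a : Fin n →₀ ℕ, p = monomial a (1 : K) ∧
      monomial a (1 : K) ∈ I ∧ monomial a (1 : K) ∉ J}

/-- The family `(a i, Z i), i = 1,…,r` is a Stanley decomposition of the module `I/J`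
(represented by the span of the monomials of `I \ J`): the Stanley spaces
`(a i)·K[Z i]` are independent and their (direct) sum is all of `I/J`. -/
def IsStanleyDecomp (K : Type*) [Field K] {n r : ℕ}
    (I J : Ideal (MvPolynomial (Fin n) K))
    (a : Fin r → (Fin n →₀ ℕ)) (Z : Fin r → Finset (Fin n)) : Prop :=
  iSupIndep (fun i => StanleySpace K (a i) (Z i)) ∧
    (⨆ i, StanleySpace K (a i) (Z i)) = monomialSpan K I J

/-- The Stanley depth `sdepth_S (I/J)` of the module `I/J`, where `J ⊆ I ⊆ S` are
monomial ideals: the largest `d` such that there is a Stanley decomposition of `I/J`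
all of whose Stanley spaces use at least `d` variables.  (As `ℕ∞`: the Stanley depth
of the zero module, which admits the empty decomposition, is `⊤`.)
`sdepth K I ⊥` is `sdepth_S I` and `sdepth K ⊤ I` is `sdepth_S (S/I)`. -/
noncomputable def sdepth (K : Type*) [Field K] {n : ℕ}
    (I J : Ideal (MvPolynomial (Fin n) K)) : ℕ∞ :=
  sSup {d : ℕ∞ | ∃ (r : ℕ) (a : Fin r → (Fin n →₀ ℕ)) (Z : Fin r → Finset (Fin n)),
    IsStanleyDecomp K I J a Z ∧ ∀ i, d ≤ ((Z i).card : ℕ∞)}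

/-- The depth `depth_S M` of an `S`-module `M` with respect to the maximal graded
ideal `(x_0,…,x_{n-1})`: the supremum of the lengths of `M`-regular sequences
contained in that ideal. -/
noncomputable def gradedDepth (K : Type*) [Field K] (n : ℕ) (M : Type*)
    [AddCommGroup M] [Module (MvPolynomial (Fin n) K) M] : ℕ∞ :=
  sSup {k : ℕ∞ | ∃ rs : List (MvPolynomial (Fin n) K), (rs.length : ℕ∞) = k ∧
    (∀ x ∈ rs, x ∈ Ideal.span (Set.range (X : Fin n → MvPolynomial (Fin n) K))) ∧
    RingTheory.Sequence.IsRegular M rs}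

/-- Extension of an ideal along an inclusion of polynomial rings induced by a map
of variables (`IS`, for `f` injective). -/
noncomputable def extIdeal {K : Type*} [Field K] {m n : ℕ} (f : Fin m → Fin n)
    (I : Ideal (MvPolynomial (Fin m) K)) : Ideal (MvPolynomial (Fin n) K) :=
  Ideal.map (rename f : MvPolynomial (Fin m) K →ₐ[K] MvPolynomial (Fin n) K) I

/-- The inclusion of the variables of `S'' = K[x_{r+1},…,x_n]` into those of
`S = K[x_1,…,x_n]` (variables indexed from `0`). -/
def sndEmbed {n r : ℕ} (h : r ≤ n) : Fin (n - r) → Fin n :=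
  fun i => ⟨r + i.1, by have := i.2; omega⟩

/-- The inclusion of the variables of `S'' = K[x_s,…,x_n]` into those of
`S = K[x_1,…,x_n]` (variables indexed from `0`). -/
def midEmbed {n s : ℕ} (hs : 1 ≤ s) (hsn : s ≤ n) : Fin (n + 1 - s) → Fin n :=
  fun i => ⟨s - 1 + i.1, by have := i.2; omega⟩

/-- The set of exponent vectors of the monomials of `m·K[Z]`, where `m` has exponent vector `a`. -/
def stanleyCone {σ : Type*} (a : σ →₀ ℕ) (Z : Finset σ) : Set (σ →₀ ℕ) :=
  {x | a ≤ x ∧ ∀ j ∉ Z, x j = a j}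

/-- `U` is partitioned by finitely many cones `stanleyCone (a i) (Z i)` with `d ≤ |Z i|`. -/
def HasConePartition {σ : Type*} (U : Set (σ →₀ ℕ)) (d : ℕ∞) : Prop :=
  ∃ (k : ℕ) (a : Fin k → (σ →₀ ℕ)) (Z : Fin k → Finset σ),
    (∀ x, x ∈ U ↔ ∃ i, x ∈ stanleyCone (a i) (Z i)) ∧
    (∀ i j x, x ∈ stanleyCone (a i) (Z i) → x ∈ stanleyCone (a j) (Z j) → i = j) ∧
    ∀ i, d ≤ ((Z i).card : ℕ∞)

theorem HasConePartition.of_finite {σ ι : Type*} [Finite ι] {U : Set (σ →₀ ℕ)} {d : ℕ∞}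
    (a : ι → (σ →₀ ℕ)) (Z : ι → Finset σ)
    (hU : ∀ x, x ∈ U ↔ ∃ i, x ∈ stanleyCone (a i) (Z i))
    (hdisj : ∀ i j x, x ∈ stanleyCone (a i) (Z i) → x ∈ stanleyCone (a j) (Z j) → i = j)
    (hd : ∀ i, d ≤ ((Z i).card : ℕ∞)) : HasConePartition U d := by
  obtain ⟨k, ⟨e⟩⟩ := Finite.exists_equiv_fin ι
  refine ⟨k, a ∘ e.symm, Z ∘ e.symm, fun x => ?_, fun i j x hi hj => ?_, fun i => hd _⟩
  · rw [hU, e.symm.surjective.exists]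
    rfl
  · exact e.symm.injective (hdisj _ _ x hi hj)

theorem HasConePartition.union {σ : Type*} {U V : Set (σ →₀ ℕ)} {c d : ℕ∞}
    (hU : HasConePartition U c) (hV : HasConePartition V d) (hUV : Disjoint U V) :
    HasConePartition (U ∪ V) (min c d) := by
  obtain ⟨k, a, Z, h1, h2, h3⟩ := hU
  obtain ⟨l, b, Y, g1, g2, g3⟩ := hV
  rw [Set.disjoint_left] at hUV
  refine .of_finite (Sum.elim a b) (Sum.elim Z Y) (fun x => ?_) ?_ ?_
  · simp [h1, g1]
  · rintro (i | i) (j | j) x hi hj <;> simp only [Sum.elim_inl, Sum.elim_inr] at hi hj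
    · rw [h2 i j x hi hj]
    · exact absurd ((g1 x).2 ⟨_, hj⟩) (hUV ((h1 x).2 ⟨_, hi⟩))
    · exact absurd ((g1 x).2 ⟨_, hi⟩) (hUV ((h1 x).2 ⟨_, hj⟩))
    · rw [g2 i j x hi hj]
  · rintro (i | i)
    · exact (min_le_left _ _).trans (h3 i)
    · exact (min_le_right _ _).trans (g3 i)

/-- A set that is determined by truncation at a fixed exponent vector has a cone partition. -/
theorem hasConePartition_zero_of_inf_mem_iff {σ : Type*} [Finite σ] {U : Set (σ →₀ ℕ)}
    (g : σ →₀ ℕ) (hg : ∀ x, x ∈ U ↔ x ⊓ g ∈ U) : HasConePartition U 0 := by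
  classical
  have := Fintype.ofFinite σ
  have : Finite {b : σ →₀ ℕ // b ≤ g ∧ b ∈ U} :=
    ((Set.finite_Iic g).subset fun b hb => hb.1 : {b : σ →₀ ℕ | b ≤ g ∧ b ∈ U}.Finite)
  have key : ∀ b : σ →₀ ℕ, b ≤ g → ∀ x,
      x ∈ stanleyCone b (Finset.univ.filter fun j => b j = g j) ↔ x ⊓ g = b := by
    intro b hb x
    constructor
    · rintro ⟨h1, h2⟩
      ext j
      have := h1 j
      have := hb j
      have := h2 j
      simp only [Finset.mem_filter, Finset.mem_univ, true_and] at this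
      rw [Finsupp.inf_apply]
      by_cases hj : b j = g j <;> grind
    · rintro rfl
      refine ⟨inf_le_left, fun j hj => ?_⟩
      rw [Finset.mem_filter_univ] at hj
      rw [Finsupp.inf_apply] at hj ⊢
      grind
  refine .of_finite (ι := {b : σ →₀ ℕ // b ≤ g ∧ b ∈ U}) (fun b => b.1)
    (fun b => Finset.univ.filter fun j => b.1 j = g j) (fun x => ?_) ?_ (fun _ => zero_le)
  · constructor
    · intro hx
      exact ⟨⟨x ⊓ g, inf_le_right, (hg x).1 hx⟩, (key _ inf_le_right x).2 rfl⟩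
    · rintro ⟨b, hb⟩
      rw [key _ b.2.1] at hb
      rw [hg, hb]
      exact b.2.2
  · intro b c x hb hc
    rw [key _ b.2.1] at hb
    rw [key _ c.2.1] at hc
    exact Subtype.ext (hb.symm.trans hc)

/-- Membership in an upper set of exponent vectors is determined by a truncation. -/
theorem IsUpperSet.exists_inf_mem_iff {σ : Type*} [Finite σ] {U : Set (σ →₀ ℕ)}
    (hU : IsUpperSet U) : ∃ g : σ →₀ ℕ, ∀ x, x ∈ U ↔ x ⊓ g ∈ U := by
  have hfin : {m | Minimal (· ∈ U) m}.Finite :=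
    WellQuasiOrderedLE.finite_of_isAntichain (setOfPred_minimal_antichain _)
  refine ⟨hfin.toFinset.sup id, fun x => ⟨fun hx => ?_, fun hx => hU inf_le_left hx⟩⟩
  obtain ⟨m, hmx, hm⟩ := exists_minimal_le_of_wellFoundedLT (· ∈ U) x hx
  refine hU (le_inf hmx ?_) hm.1
  exact Finset.le_sup (f := id) (hfin.mem_toFinset.2 hm)

theorem IsUpperSet.hasConePartition_zero {σ : Type*} [Finite σ] {U : Set (σ →₀ ℕ)}
    (hU : IsUpperSet U) : HasConePartition U 0 :=
  let ⟨g, hg⟩ := hU.exists_inf_mem_iff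
  hasConePartition_zero_of_inf_mem_iff g hg

theorem IsUpperSet.hasConePartition_compl_zero {σ : Type*} [Finite σ] {U : Set (σ →₀ ℕ)}
    (hU : IsUpperSet U) : HasConePartition Uᶜ 0 :=
  let ⟨g, hg⟩ := hU.exists_inf_mem_iff
  hasConePartition_zero_of_inf_mem_iff g fun x => not_congr (hg x)

section DisjointVariables

variable {α β σ : Type*} {f : α → σ} {g : β → σ}

/-- Restrict an exponent vector along an injective map of variables. -/
noncomputable def pullExp (f : α → σ) (hf : f.Injective) (x : σ →₀ ℕ) : α →₀ ℕ :=
  x.comapDomain f hf.injOn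

@[simp]
theorem pullExp_apply (hf : f.Injective) (x : σ →₀ ℕ) (i : α) : pullExp f hf x i = x (f i) := rfl

theorem mapDomain_le_iff_le_pullExp (hf : f.Injective) (a : α →₀ ℕ) (x : σ →₀ ℕ) :
    a.mapDomain f ≤ x ↔ a ≤ pullExp f hf x := by
  constructor
  · intro h i
    simpa [Finsupp.mapDomain_apply hf] using h (f i)
  · intro h j
    by_cases hj : j ∈ Set.range f
    · obtain ⟨i, rfl⟩ := hj
      simpa [Finsupp.mapDomain_apply hf] using h i
    · simp [Finsupp.mapDomain_of_notMem_range _ _ hj]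

theorem HasConePartition.prod (hf : f.Injective) (hg : g.Injective)
    (hfg : IsCompl (Set.range f) (Set.range g))
    {A : Set (α →₀ ℕ)} {B : Set (β →₀ ℕ)} {c d : ℕ∞}
    (hA : HasConePartition A c) (hB : HasConePartition B d) :
    HasConePartition (pullExp f hf ⁻¹' A ∩ pullExp g hg ⁻¹' B) (c + d) := by
  classical
  obtain ⟨k, a, Z, h1, h2, h3⟩ := hA
  obtain ⟨l, b, Y, g1, g2, g3⟩ := hB
  have hne : ∀ i j, f i ≠ g j := fun i j h =>
    Set.disjoint_left.1 hfg.disjoint ⟨i, rfl⟩ ⟨j, h.symm⟩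
  have hcov : ∀ s, s ∈ Set.range f ∨ s ∈ Set.range g := fun s => by
    rw [← hfg.compl_eq]
    exact em _
  have key : ∀ a Z b Y x, x ∈ stanleyCone (a.mapDomain f + b.mapDomain g)
      (Z.map ⟨f, hf⟩ ∪ Y.map ⟨g, hg⟩) ↔
      pullExp f hf x ∈ stanleyCone a Z ∧ pullExp g hg x ∈ stanleyCone b Y := by
    intro a Z b Y x
    have hl : ∀ i, (a.mapDomain f + b.mapDomain g) (f i) = a i := fun i => by
      rw [Finsupp.add_apply, Finsupp.mapDomain_apply hf, Finsupp.mapDomain_of_notMem_range, add_zero]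
      rintro ⟨j, hj⟩
      exact hne i j hj.symm
    have hr : ∀ j, (a.mapDomain f + b.mapDomain g) (g j) = b j := fun j => by
      rw [Finsupp.add_apply, Finsupp.mapDomain_apply hg, Finsupp.mapDomain_of_notMem_range, zero_add]
      rintro ⟨i, hi⟩
      exact hne i j hi
    have hZl : ∀ i, f i ∈ Z.map ⟨f, hf⟩ ∪ Y.map ⟨g, hg⟩ ↔ i ∈ Z := fun i => by
      simp [(hne _ _).symm]
    have hZr : ∀ j, g j ∈ Z.map ⟨f, hf⟩ ∪ Y.map ⟨g, hg⟩ ↔ j ∈ Y := fun j => by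
      simp [hne]
    constructor
    · rintro ⟨p, q⟩
      refine ⟨⟨fun i => ?_, fun i hi => ?_⟩, ⟨fun j => ?_, fun j hj => ?_⟩⟩
      · exact (hl i).symm.trans_le (p (f i))
      · exact (q (f i) ((hZl i).not.2 hi)).trans (hl i)
      · exact (hr j).symm.trans_le (p (g j))
      · exact (q (g j) ((hZr j).not.2 hj)).trans (hr j)
    · rintro ⟨⟨p, q⟩, ⟨p', q'⟩⟩
      refine ⟨fun s => ?_, fun s hs => ?_⟩
      · obtain ⟨i, rfl⟩ | ⟨j, rfl⟩ := hcov s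
        · exact (hl i).trans_le (p i)
        · exact (hr j).trans_le (p' j)
      · obtain ⟨i, rfl⟩ | ⟨j, rfl⟩ := hcov s
        · exact (q i ((hZl i).not.1 hs)).trans (hl i).symm
        · exact (q' j ((hZr j).not.1 hs)).trans (hr j).symm
  refine .of_finite (ι := Fin k × Fin l)
    (fun p => (a p.1).mapDomain f + (b p.2).mapDomain g)
    (fun p => (Z p.1).map ⟨f, hf⟩ ∪ (Y p.2).map ⟨g, hg⟩) (fun x => ?_) ?_ ?_
  · simp only [key, Set.mem_inter_iff, Set.mem_preimage, h1, g1, Prod.exists]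
    exact exists_and_exists_comm
  · rintro ⟨i, i'⟩ ⟨j, j'⟩ x hi hj
    rw [key] at hi hj
    rw [h2 i j _ hi.1 hj.1, g2 i' j' _ hi.2 hj.2]
  · rintro ⟨i, i'⟩
    rw [Finset.card_union_of_disjoint, Finset.card_map, Finset.card_map, Nat.cast_add]
    · exact add_le_add (h3 i) (g3 i')
    · simp only [Finset.disjoint_left, Finset.mem_map, Function.Embedding.coeFn_mk]
      rintro _ ⟨i, -, rfl⟩ ⟨j, -, hj⟩
      exact hne i j hj.symm

/-- If `0 ∉ V`, a cone partition of `U × ℕ^β ∪ ℕ^α × V` restricts to `ℕ^α × {0}`, giving a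
cone partition of `U × ℕ^β`. -/
theorem HasConePartition.of_union_preimage [Finite σ] (hf : f.Injective) (hg : g.Injective)
    (hfg : IsCompl (Set.range f) (Set.range g))
    {U : Set (α →₀ ℕ)} {V : Set (β →₀ ℕ)} {d : ℕ∞} (hV : 0 ∉ V)
    (h : HasConePartition (pullExp f hf ⁻¹' U ∪ pullExp g hg ⁻¹' V) d) :
    HasConePartition (pullExp f hf ⁻¹' U) d := by
  classical
  have := Fintype.ofFinite σ
  obtain ⟨k, a, Z, h1, h2, h3⟩ := h
  have hne : ∀ i j, f i ≠ g j := fun i j h =>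
    Set.disjoint_left.1 hfg.disjoint ⟨i, rfl⟩ ⟨j, h.symm⟩
  set trunc : (σ →₀ ℕ) → (σ →₀ ℕ) := fun x => x.filter (· ∉ Set.range g) with htrunc
  have hmem : ∀ x, x ∈ pullExp f hf ⁻¹' U ↔
      trunc x ∈ pullExp f hf ⁻¹' U ∪ pullExp g hg ⁻¹' V := by
    intro x
    have e1 : pullExp f hf (trunc x) = pullExp f hf x := by
      ext i
      exact Finsupp.filter_apply_pos (· ∉ Set.range g) _ fun ⟨j, hj⟩ => hne i j hj.symm
    have e2 : pullExp g hg (trunc x) = 0 := by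
      ext j
      exact Finsupp.filter_apply_neg (· ∉ Set.range g) _ fun h => h ⟨j, rfl⟩
    simp [e1, e2, hV]
  have key : ∀ b Y, pullExp g hg b = 0 → ∀ x,
      x ∈ stanleyCone b (Y ∪ Finset.univ.filter (· ∈ Set.range g)) ↔
        trunc x ∈ stanleyCone b Y := by
    intro b Y hb x
    have hb' : ∀ s ∈ Set.range g, b s = 0 := by
      rintro _ ⟨j, rfl⟩
      exact DFunLike.congr_fun hb j
    have t1 : ∀ s ∉ Set.range g, trunc x s = x s := fun s hs => Finsupp.filter_apply_pos _ _ hs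
    have t2 : ∀ s ∈ Set.range g, trunc x s = 0 := fun s hs =>
      Finsupp.filter_apply_neg _ _ (not_not.2 hs)
    constructor
    · rintro ⟨p, q⟩
      refine ⟨fun s => ?_, fun s hs => ?_⟩ <;> by_cases hsg : s ∈ Set.range g
      · exact (hb' s hsg).trans_le zero_le
      · exact (p s).trans_eq (t1 s hsg).symm
      · rw [t2 s hsg, hb' s hsg]
      · rw [t1 s hsg]
        exact q s (by simp [hs] at hsg ⊢; exact hsg)
    · rintro ⟨p, q⟩
      refine ⟨fun s => ?_, fun s hs => ?_⟩
      · by_cases hsg : s ∈ Set.range g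
        · exact (hb' s hsg).trans_le zero_le
        · exact (p s).trans_eq (t1 s hsg)
      · rw [Finset.mem_union, not_or, Finset.mem_filter, not_and] at hs
        rw [← t1 s (hs.2 (Finset.mem_univ s))]
        exact q s hs.1
  have hzero : ∀ i x, trunc x ∈ stanleyCone (a i) (Z i) → pullExp g hg (a i) = 0 := by
    rintro i x ⟨p, -⟩
    ext j
    have := p (g j)
    rw [htrunc, Finsupp.filter_apply_neg _ _ fun h => h ⟨j, rfl⟩] at this
    exact Nat.le_zero.1 this
  refine .of_finite (ι := {i // pullExp g hg (a i) = 0}) (fun i => a i)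
    (fun i => Z i ∪ Finset.univ.filter (· ∈ Set.range g)) (fun x => ?_) ?_ ?_
  · rw [hmem, h1]
    constructor
    · rintro ⟨i, hi⟩
      exact ⟨⟨i, hzero i x hi⟩, (key _ _ (hzero i x hi) x).2 hi⟩
    · rintro ⟨i, hi⟩
      exact ⟨i, (key _ _ i.2 x).1 hi⟩
  · intro i j x hi hj
    rw [key _ _ i.2] at hi
    rw [key _ _ j.2] at hj
    exact Subtype.ext (h2 _ _ _ hi hj)
  · intro i
    exact (h3 i).trans (Nat.cast_le.2 (Finset.card_le_card Finset.subset_union_left))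

end DisjointVariables

section Translation

variable {K : Type*} [Field K] {n : ℕ}

theorem StanleySpace_eq_restrictSupport (a : Fin n →₀ ℕ) (Z : Finset (Fin n)) :
    StanleySpace K a Z = restrictSupport K (stanleyCone a Z) := by
  rw [StanleySpace, restrictSupport_eq_span]
  congr 1
  ext p
  constructor
  · rintro ⟨c, hc, rfl⟩
    refine ⟨a + c, ⟨le_self_add, fun j hj => ?_⟩, rfl⟩
    have : c j = 0 := Finsupp.notMem_support_iff.1 fun h => hj (hc h)
    simp [this]
  · rintro ⟨x, ⟨hx, hZ⟩, rfl⟩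
    refine ⟨x - a, fun j hj => ?_, by rw [add_tsub_cancel_of_le hx]⟩
    by_contra h
    simp [hZ j h] at hj

theorem monomialSpan_eq_restrictSupport (I J : Ideal (MvPolynomial (Fin n) K)) :
    monomialSpan K I J =
      restrictSupport K {a | monomial a (1 : K) ∈ I ∧ monomial a (1 : K) ∉ J} := by
  rw [monomialSpan, restrictSupport_eq_span]
  congr 1
  ext p
  constructor
  · rintro ⟨a, rfl, h⟩
    exact ⟨a, h, rfl⟩
  · rintro ⟨a, h, rfl⟩
    exact ⟨a, rfl, h⟩

theorem restrictSupport_iUnion {ι : Sort*} {σ : Type*} (s : ι → Set (σ →₀ ℕ)) :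
    restrictSupport K (⋃ i, s i) = ⨆ i, restrictSupport K (s i) := by
  simp only [restrictSupport_eq_span, Set.image_iUnion, Submodule.span_iUnion]

theorem restrictSupport_injective {σ : Type*} :
    Function.Injective (restrictSupport K : Set (σ →₀ ℕ) → _) := by
  intro s t h
  ext a
  simpa using SetLike.ext_iff.1 h (monomial a (1 : K))

theorem disjoint_restrictSupport_iff {σ : Type*} {s t : Set (σ →₀ ℕ)} :
    Disjoint (restrictSupport K s) (restrictSupport K t) ↔ Disjoint s t := by
  rw [Submodule.disjoint_def, Set.disjoint_left]
  constructor
  · intro h a hs ht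
    simpa using h (monomial a (1 : K)) (by simpa using hs) (by simpa using ht)
  · intro h p hs ht
    rw [mem_restrictSupport_iff] at hs ht
    rw [← support_eq_empty, Finset.eq_empty_iff_forall_notMem]
    exact fun a ha => h (hs ha) (ht ha)

theorem isStanleyDecomp_iff {r : ℕ} (I J : Ideal (MvPolynomial (Fin n) K))
    (a : Fin r → (Fin n →₀ ℕ)) (Z : Fin r → Finset (Fin n)) :
    IsStanleyDecomp K I J a Z ↔
      (∀ x, x ∈ {a | monomial a (1 : K) ∈ I ∧ monomial a (1 : K) ∉ J} ↔
        ∃ i, x ∈ stanleyCone (a i) (Z i)) ∧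
      ∀ i j x, x ∈ stanleyCone (a i) (Z i) → x ∈ stanleyCone (a j) (Z j) → i = j := by
  simp only [IsStanleyDecomp, StanleySpace_eq_restrictSupport, monomialSpan_eq_restrictSupport,
    iSupIndep, ← restrictSupport_iUnion, disjoint_restrictSupport_iff]
  rw [restrictSupport_injective.eq_iff, and_comm]
  refine and_congr ?_ ?_
  · rw [Set.ext_iff]
    exact forall_congr' fun x => by rw [Set.mem_iUnion]; exact iff_comm
  · simp only [Set.disjoint_left, Set.mem_iUnion, not_exists]
    exact ⟨fun h i j x hi hj => by_contra fun hij => h i hi j (Ne.symm hij) hj,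
      fun h i x hi j hij hj => hij (h i j x hi hj).symm⟩

theorem sdepth_eq_sSup_hasConePartition (I J : Ideal (MvPolynomial (Fin n) K)) :
    sdepth K I J = sSup {d | HasConePartition
      {a | monomial a (1 : K) ∈ I ∧ monomial a (1 : K) ∉ J} d} := by
  simp only [sdepth, HasConePartition, isStanleyDecomp_iff, and_assoc]

/-- The exponent vectors of the monomials in `I`. -/
def exponentSet (I : Ideal (MvPolynomial (Fin n) K)) : Set (Fin n →₀ ℕ) :=
  {a | monomial a (1 : K) ∈ I}

theorem sdepth_bot_right (I : Ideal (MvPolynomial (Fin n) K)) :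
    sdepth K I ⊥ = sSup {d | HasConePartition (exponentSet I) d} := by
  simp [sdepth_eq_sSup_hasConePartition, exponentSet]

theorem sdepth_top_left (I : Ideal (MvPolynomial (Fin n) K)) :
    sdepth K ⊤ I = sSup {d | HasConePartition (exponentSet I)ᶜ d} := by
  simp [sdepth_eq_sSup_hasConePartition, exponentSet, Set.compl_def]

theorem mem_exponentSet_span {G : Set (Fin n →₀ ℕ)} {x : Fin n →₀ ℕ} :
    x ∈ exponentSet (Ideal.span ((fun a => monomial a (1 : K)) '' G)) ↔ ∃ g ∈ G, g ≤ x := by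
  classical
  change monomial x (1 : K) ∈ Ideal.span ((fun a => monomial a (1 : K)) '' G) ↔ _
  rw [mem_ideal_span_monomial_image, support_monomial, if_neg one_ne_zero]
  simp

theorem IsMonomialIdeal.isUpperSet_exponentSet {I : Ideal (MvPolynomial (Fin n) K)}
    (hI : IsMonomialIdeal I) : IsUpperSet (exponentSet I) := by
  obtain ⟨G, rfl⟩ := hI
  intro x y hxy hx
  rw [mem_exponentSet_span] at hx ⊢
  obtain ⟨g, hg, hgx⟩ := hx
  exact ⟨g, hg, hgx.trans hxy⟩

theorem extIdeal_span_monomial {m : ℕ} (f : Fin m → Fin n) (G : Set (Fin m →₀ ℕ)) :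
    extIdeal f (Ideal.span ((fun a => monomial a (1 : K)) '' G)) =
      Ideal.span ((fun a => monomial a (1 : K)) '' (Finsupp.mapDomain f '' G)) := by
  rw [extIdeal, Ideal.map_span, Set.image_image, Set.image_image]
  simp [rename_monomial]

theorem IsMonomialIdeal.extIdeal {m : ℕ} {I : Ideal (MvPolynomial (Fin m) K)}
    (hI : IsMonomialIdeal I) (f : Fin m → Fin n) : IsMonomialIdeal (extIdeal f I) := by
  obtain ⟨G, rfl⟩ := hI
  exact ⟨_, extIdeal_span_monomial f G⟩

theorem IsMonomialIdeal.exponentSet_extIdeal {m : ℕ} {I : Ideal (MvPolynomial (Fin m) K)}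
    (hI : IsMonomialIdeal I) {f : Fin m → Fin n} (hf : f.Injective) :
    exponentSet (_root_.extIdeal f I) = pullExp f hf ⁻¹' exponentSet I := by
  obtain ⟨G, rfl⟩ := hI
  ext x
  rw [extIdeal_span_monomial, Set.mem_preimage, mem_exponentSet_span, mem_exponentSet_span,
    Set.exists_mem_image]
  simp only [mapDomain_le_iff_le_pullExp hf]

theorem IsMonomialIdeal.exponentSet_sup {I J : Ideal (MvPolynomial (Fin n) K)}
    (hI : IsMonomialIdeal I) (hJ : IsMonomialIdeal J) :
    exponentSet (I ⊔ J) = exponentSet I ∪ exponentSet J := by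
  obtain ⟨G, rfl⟩ := hI
  obtain ⟨H, rfl⟩ := hJ
  ext x
  rw [← Ideal.span_union, ← Set.image_union, Set.mem_union]
  simp only [mem_exponentSet_span, Set.mem_union, or_and_right, exists_or]

theorem zero_notMem_exponentSet {I : Ideal (MvPolynomial (Fin n) K)} (hI : I ≠ ⊤) :
    0 ∉ exponentSet I := by
  intro h
  exact hI ((Ideal.eq_top_iff_one I).2 h)

end Translation

theorem sndEmbed_injective {n r : ℕ} (h : r ≤ n) : (sndEmbed h).Injective := by
  intro i j hij
  simpa [sndEmbed, Fin.ext_iff] using hij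

theorem isCompl_range_castLE_sndEmbed {n r : ℕ} (h : r ≤ n) :
    IsCompl (Set.range (Fin.castLE h)) (Set.range (sndEmbed h)) := by
  constructor
  · rw [Set.disjoint_left]
    rintro _ ⟨i, rfl⟩ ⟨j, hj⟩
    have := i.2
    simp only [sndEmbed, Fin.ext_iff, Fin.val_castLE] at hj
    omega
  · rw [codisjoint_iff_le_sup]
    intro s _
    by_cases hs : s.1 < r
    · exact Or.inl ⟨⟨s, hs⟩, rfl⟩
    · exact Or.inr ⟨⟨s - r, by omega⟩, Fin.ext (by simp only [sndEmbed]; omega)⟩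

/-- For monomial ideals `I ⊂ S' = K[x_1,…,x_r]` and
`J ⊂ S'' = K[x_{r+1},…,x_n]` with `1 ≤ r < n`, one has
`sdepth_S(IS) ≥ sdepth_S(IS+JS) ≥ min(sdepth_S(IS), sdepth_{S''}(J) + sdepth_{S'}(S'/I))`. -/
theorem sdepth_sup_bounds_disjoint_vars {K : Type*} [Field K] {n r : ℕ}
    (h1 : 1 ≤ r) (h2 : r < n)
    (I : Ideal (MvPolynomial (Fin r) K)) (J : Ideal (MvPolynomial (Fin (n - r)) K))
    (hmI : IsMonomialIdeal I) (hmJ : IsMonomialIdeal J)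
    (hI0 : I ≠ ⊥) (hI1 : I ≠ ⊤) (hJ0 : J ≠ ⊥) (hJ1 : J ≠ ⊤) :
    sdepth K (extIdeal (Fin.castLE h2.le) I) ⊥ ≥
      sdepth K (extIdeal (Fin.castLE h2.le) I ⊔ extIdeal (sndEmbed h2.le) J) ⊥ ∧
    sdepth K (extIdeal (Fin.castLE h2.le) I ⊔ extIdeal (sndEmbed h2.le) J) ⊥ ≥
      min (sdepth K (extIdeal (Fin.castLE h2.le) I) ⊥) (sdepth K J ⊥ + sdepth K ⊤ I) := by
  have hf : (Fin.castLE h2.le).Injective := Fin.castLE_injective h2.le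
  have hg := sndEmbed_injective h2.le
  have hfg := isCompl_range_castLE_sndEmbed h2.le
  rw [sdepth_bot_right, sdepth_bot_right, sdepth_bot_right, sdepth_top_left,
    (hmI.extIdeal _).exponentSet_sup (hmJ.extIdeal _), hmI.exponentSet_extIdeal hf,
    hmJ.exponentSet_extIdeal hg]
  refine ⟨sSup_le_sSup fun d hd =>
    HasConePartition.of_union_preimage hf hg hfg (zero_notMem_exponentSet hJ1) hd, ?_⟩
  have hadd : sSup {d | HasConePartition (exponentSet J) d} +
      sSup {d | HasConePartition (exponentSet I)ᶜ d} ≤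
      sSup {d | HasConePartition (pullExp _ hf ⁻¹' (exponentSet I)ᶜ ∩
        pullExp _ hg ⁻¹' exponentSet J) d} := by
    rw [sSup_eq_iSup, sSup_eq_iSup]
    refine ENat.biSup_add_biSup_le ⟨0, hmJ.isUpperSet_exponentSet.hasConePartition_zero⟩
      ⟨0, hmI.isUpperSet_exponentSet.hasConePartition_compl_zero⟩ fun c hc d hd => ?_
    rw [add_comm]
    exact le_sSup (HasConePartition.prod hf hg hfg hd hc)
  refine (min_le_min_left _ hadd).trans ?_
  rw [sSup_inf_sSup]
  refine iSup₂_le fun p hp => le_sSup ?_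
  have := hp.1.union hp.2 (Set.disjoint_left.2 fun x hx hx' => hx'.1 hx)
  refine (congrArg (HasConePartition · _) ?_).mp this
  ext x
  simp only [Set.mem_union, Set.mem_inter_iff, Set.mem_preimage, Set.mem_compl_iff]
  tauto
end

section
/- Let 1 ≤ s ≤ r+1 ≤ n with n ≥ 2, set p = r − s + 1, and let u ∈ K[x_1,…,x_r], v ∈ K[x_s,…,x_n] be monomials. Let Z ⊆ {x_1,…,x_r} and W ⊆ {x_s,…,x_n}, and set Z̄ = Z ∪ {x_{r+1},…,x_n} and W̄ = W ∪ {x_1,…,x_{s−1}}. If L = uK[Z̄] ∩ vK[W̄], then either L = {0} or L = lcm(u,v)K[(Z ∪ W) \ Y] for some subset Y ⊆ {x_s,…,x_r}, and in the latter case |(Z ∪ W) \ Y| ≥ |Z| + |W| − p. -/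
open MvPolynomial

/-- The exponents of the monomials in the Stanley space `a·K[Z]`. -/
def stanleyExponents {n : ℕ} (a : Fin n →₀ ℕ) (Z : Finset (Fin n)) : Set (Fin n →₀ ℕ) :=
  {d | a ≤ d ∧ ∀ i ∉ Z, d i = a i}

theorem stanleySpace_eq_restrictSupport (K : Type*) [Field K] {n : ℕ} (a : Fin n →₀ ℕ)
    (Z : Finset (Fin n)) :
    StanleySpace K a Z = restrictSupport K (stanleyExponents a Z) := by
  rw [restrictSupport_eq_span, StanleySpace]
  congr 1
  ext p
  constructor
  · rintro ⟨c, hc, rfl⟩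
    refine ⟨a + c, ⟨le_self_add, fun i hi => ?_⟩, rfl⟩
    simpa using Finsupp.notMem_support_iff.mp fun h => hi (hc h)
  · rintro ⟨d, ⟨had, hd⟩, rfl⟩
    refine ⟨d - a, fun i hi => ?_, by rw [add_tsub_cancel_of_le had]⟩
    by_contra hiZ
    simp [hd i hiZ] at hi

theorem stanleyExponents_inter {n : ℕ} {a b : Fin n →₀ ℕ} {A B : Finset (Fin n)}
    (h : (stanleyExponents a A ∩ stanleyExponents b B).Nonempty) :
    stanleyExponents a A ∩ stanleyExponents b B = stanleyExponents (a ⊔ b) (A ∩ B) := by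
  obtain ⟨e, ⟨hae, heA⟩, hbe, heB⟩ := h
  have hA : ∀ i ∉ A, (a ⊔ b) i = a i := fun i hi =>
    sup_eq_left.mpr ((hbe i).trans (heA i hi).le)
  have hB : ∀ i ∉ B, (a ⊔ b) i = b i := fun i hi =>
    sup_eq_right.mpr ((hae i).trans (heB i hi).le)
  ext d
  constructor
  · rintro ⟨⟨had, hdA⟩, hbd, hdB⟩
    refine ⟨sup_le had hbd, fun i hi => ?_⟩
    by_cases hiA : i ∈ A
    · have hiB : i ∉ B := fun hiB => hi (Finset.mem_inter.mpr ⟨hiA, hiB⟩)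
      rw [hB i hiB, hdB i hiB]
    · rw [hA i hiA, hdA i hiA]
  · rintro ⟨hd, hdAB⟩
    refine ⟨⟨le_sup_left.trans hd, fun i hi => ?_⟩, le_sup_right.trans hd, fun i hi => ?_⟩
    · rw [hdAB i fun h => hi (Finset.mem_inter.mp h).1, hA i hi]
    · rw [hdAB i fun h => hi (Finset.mem_inter.mp h).2, hB i hi]

theorem stanleySpace_inf (K : Type*) [Field K] {n : ℕ} (a b : Fin n →₀ ℕ)
    (A B : Finset (Fin n)) :
    StanleySpace K a A ⊓ StanleySpace K b B = ⊥ ∨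
      StanleySpace K a A ⊓ StanleySpace K b B = StanleySpace K (a ⊔ b) (A ∩ B) := by
  have hinf : StanleySpace K a A ⊓ StanleySpace K b B =
      restrictSupport K (stanleyExponents a A ∩ stanleyExponents b B) := by
    ext p
    simp only [stanleySpace_eq_restrictSupport, Submodule.mem_inf, mem_restrictSupport_iff,
      Set.subset_inter_iff]
  rw [hinf]
  rcases Set.eq_empty_or_nonempty (stanleyExponents a A ∩ stanleyExponents b B) with h | h
  · left
    rw [h, restrictSupport_eq_span, Set.image_empty, Submodule.span_empty]
  · right
    rw [stanleyExponents_inter h, stanleySpace_eq_restrictSupport]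

theorem card_filter_fin_Ico_le (n l r : ℕ) :
    (Finset.univ.filter fun i : Fin n => l ≤ i.1 ∧ i.1 < r).card ≤ r - l := by
  rw [← Nat.card_Ico]
  refine Finset.card_le_card_of_injOn Fin.val (fun i hi => ?_) Fin.val_injective.injOn
  simpa using hi

/-- Let `1 ≤ s ≤ r+1 ≤ n`, `n ≥ 2`, `p = r - s + 1`; let `u = x^a` be a
monomial in `K[x_1,…,x_r]`, `v = x^b` a monomial in `K[x_s,…,x_n]`, `Z ⊆ {x_1,…,x_r}`,
`W ⊆ {x_s,…,x_n}`, `Z̄ = Z ∪ {x_{r+1},…,x_n}` and `W̄ = W ∪ {x_1,…,x_{s-1}}`.  Then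
`L = uK[Z̄] ⊓ vK[W̄]` is either `0` or equals `lcm(u,v)·K[(Z ∪ W) \ Y]` for some
`Y ⊆ {x_s,…,x_r}`, in which case `|(Z ∪ W) \ Y| ≥ |Z| + |W| - p`.
(Variables are indexed from `0`, so `x_j` corresponds to the index `j - 1`.) -/
theorem stanleySpace_inf_mid {K : Type*} [Field K] {n r s : ℕ}
    (hs : 1 ≤ s) (hsr : s ≤ r + 1) (hrn : r + 1 ≤ n) (hn : 2 ≤ n)
    (a b : Fin n →₀ ℕ) (Z W : Finset (Fin n))
    (ha : ∀ i ∈ a.support, i.1 < r) (hb : ∀ i ∈ b.support, s - 1 ≤ i.1)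
    (hZ : ∀ i ∈ Z, i.1 < r) (hW : ∀ i ∈ W, s - 1 ≤ i.1) :
    StanleySpace K a (Z ∪ Finset.univ.filter (fun i : Fin n => r ≤ i.1)) ⊓
      StanleySpace K b (W ∪ Finset.univ.filter (fun i : Fin n => i.1 < s - 1)) = ⊥ ∨
    ∃ Y : Finset (Fin n), (∀ i ∈ Y, s - 1 ≤ i.1 ∧ i.1 < r) ∧
      StanleySpace K a (Z ∪ Finset.univ.filter (fun i : Fin n => r ≤ i.1)) ⊓
        StanleySpace K b (W ∪ Finset.univ.filter (fun i : Fin n => i.1 < s - 1)) =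
          StanleySpace K (a ⊔ b) ((Z ∪ W) \ Y) ∧
      Z.card + W.card ≤ ((Z ∪ W) \ Y).card + (r + 1 - s) := by
  set M := Finset.univ.filter fun i : Fin n => s - 1 ≤ i.1 ∧ i.1 < r with hM
  refine (stanleySpace_inf K a b _ _).imp_right fun h => ⟨M \ (Z ∩ W), ?_, ?_, ?_⟩
  · intro i hi
    simpa [hM] using (Finset.mem_sdiff.mp hi).1
  · rw [h]
    congr 1
    ext i
    have hZi := hZ i
    have hWi := hW i
    simp only [hM, Finset.mem_inter, Finset.mem_union, Finset.mem_sdiff, Finset.mem_filter,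
      Finset.mem_univ, true_and]
    grind
  · have hMcard : M.card ≤ r - (s - 1) := card_filter_fin_Ico_le n (s - 1) r
    have hsub : Z ∩ W ⊆ M := fun i hi => by
      obtain ⟨hiZ, hiW⟩ := Finset.mem_inter.mp hi
      exact Finset.mem_filter.mpr ⟨Finset.mem_univ i, hW i hiW, hZ i hiZ⟩
    have hunion := Finset.card_union_add_card_inter Z W
    have hY := Finset.card_sdiff_add_card_eq_card hsub
    have hdiff := Finset.le_card_sdiff (M \ (Z ∩ W)) (Z ∪ W)
    omega
end
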